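/- Fix an integer m ≥ 2. Then lim_{k→∞} r_ℳ(0,m,k)/m^k = 1; equivalently, the natural density of the set {n ∈ ℕ : p_ℳ(n,k) ≡ 0 (mod m)}, which equals r_ℳ(0,m,k)/m^k, tends to 1 as k → ∞. -/

import Mathlib

open Filter

/-- `pM m k n` is the number of restricted `m`-ary partitions of `n` with parts
`1, m, m^2, …, m^(k-1)`. -/
noncomputable def pM (m k n : ℕ) : ℕ :=
  Nat.card {x : Fin k → ℕ // ∑ i : Fin k, x i * m ^ (i : ℕ) = n}

/-- `rM i m k = #{n ∈ {0,…,m^k - 1} : p_ℳ(n,k) ≡ i (mod m)}`. -/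
noncomputable def rM (i m k : ℕ) : ℕ :=
  ((Finset.range (m ^ k)).filter (fun n : ℕ => pM m k n % m = i)).card

theorem sum_mul_pow_succ (m k : ℕ) (x : Fin (k + 1) → ℕ) :
    ∑ i, x i * m ^ (i : ℕ) = x 0 + m * ∑ i : Fin k, x i.succ * m ^ (i : ℕ) := by
  simp only [Fin.sum_univ_succ, Fin.val_zero, pow_zero, mul_one, Fin.val_succ, Finset.mul_sum]
  congr 1
  refine Finset.sum_congr rfl fun i _ => ?_
  ring

/-- Splitting off the number of parts equal to `1`. -/
def partitionSuccEquiv (m k n : ℕ) (hm : 0 < m) :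
    {x : Fin (k + 1) → ℕ // ∑ i, x i * m ^ (i : ℕ) = n} ≃
      Σ j : Fin (n / m + 1), {y : Fin k → ℕ // ∑ i, y i * m ^ (i : ℕ) = (j : ℕ)} where
  toFun x := ⟨⟨∑ i : Fin k, x.1 i.succ * m ^ (i : ℕ), by
    have h := x.2
    rw [sum_mul_pow_succ] at h
    rw [Nat.lt_succ_iff, Nat.le_div_iff_mul_le hm, mul_comm]
    omega⟩, ⟨fun i => x.1 i.succ, rfl⟩⟩
  invFun y := ⟨Fin.cons (n - m * y.1) y.2.1, by
    have h : m * (y.1 : ℕ) ≤ n := by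
      rw [mul_comm, ← Nat.le_div_iff_mul_le hm]
      exact Nat.lt_succ_iff.mp y.1.2
    rw [sum_mul_pow_succ]
    simp only [Fin.cons_zero, Fin.cons_succ, y.2.2]
    omega⟩
  left_inv x := by
    have h := x.2
    rw [sum_mul_pow_succ] at h
    ext i
    refine Fin.cases ?_ (fun i => ?_) i
    · simp only [Fin.cons_zero]
      omega
    · simp
  right_inv := by
    rintro ⟨⟨j, hj⟩, y, hy⟩
    change _ = j at hy
    subst hy
    rfl

theorem finite_partition (m k n : ℕ) (hm : 0 < m) :
    Finite {x : Fin k → ℕ // ∑ i, x i * m ^ (i : ℕ) = n} := by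
  induction k generalizing n with
  | zero => infer_instance
  | succ k ih =>
    have := fun n => ih n
    exact Finite.of_equiv _ (partitionSuccEquiv m k n hm).symm

theorem pM_succ (m k n : ℕ) (hm : 0 < m) :
    pM m (k + 1) n = ∑ j ∈ Finset.range (n / m + 1), pM m k j := by
  have := fun n => finite_partition m k n hm
  rw [pM, Nat.card_congr (partitionSuccEquiv m k n hm), Nat.card_sigma, Finset.sum_range]
  rfl

theorem pM_succ_mul_add (m k q a : ℕ) (ha : a < m) :
    pM m (k + 1) (m * q + a) = pM m (k + 1) (m * q) := by
  have hm : 0 < m := by omega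
  rw [pM_succ m k _ hm, pM_succ m k _ hm, Nat.mul_add_div hm, Nat.div_eq_of_lt ha,
    Nat.mul_div_cancel_left q hm, add_zero]

theorem dvd_sum_range_mul_pM (m k q : ℕ) :
    m ∣ ∑ j ∈ Finset.range (m * q), pM m (k + 1) j := by
  induction q with
  | zero => simp
  | succ q ih =>
    rw [mul_add, mul_one, Finset.sum_range_add]
    refine dvd_add ih ?_
    rw [Finset.sum_congr rfl fun a ha =>
      pM_succ_mul_add m k q a (Finset.mem_range.mp ha)]
    simp

/-- Modulo `m`, the second lowest base-`m` digit `a` of `n` contributes a factor `a + 1`. -/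
theorem pM_modEq (m k n : ℕ) (hm : 0 < m) :
    pM m (k + 2) n ≡ (n / m % m + 1) * pM m (k + 1) (n / m) [MOD m] := by
  have hr := Nat.mod_lt (n / m) hm
  have hsum : ∑ a ∈ Finset.range (n / m % m + 1), pM m (k + 1) (m * (n / m / m) + a) =
      (n / m % m + 1) * pM m (k + 1) (n / m) := by
    conv_rhs => rw [← Nat.div_add_mod (n / m) m, pM_succ_mul_add m k _ _ (by simpa using hr)]
    rw [Finset.sum_congr rfl fun a ha =>
      pM_succ_mul_add m k _ a (by have := Finset.mem_range.mp ha; omega)]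
    simp [Nat.div_add_mod]
  rw [pM_succ m (k + 1) n hm]
  conv_lhs => rw [← Nat.div_add_mod (n / m) m, add_assoc, Finset.sum_range_add, hsum]
  simpa using (Nat.modEq_zero_iff_dvd.mpr (dvd_sum_range_mul_pM m k (n / m / m))).add_right
    ((n / m % m + 1) * pM m (k + 1) (n / m))

theorem card_not_dvd_pM_le (m k : ℕ) (hm : 0 < m) :
    ((Finset.range (m ^ k)).filter fun q => ¬ m ∣ pM m (k + 1) (m * q)).card ≤ (m - 1) ^ k := by
  induction k with
  | zero => simpa using Finset.card_filter_le (Finset.range 1) _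
  | succ k ih =>
    calc _ ≤ (Finset.range (m - 1) ×ˢ
          (Finset.range (m ^ k)).filter fun q => ¬ m ∣ pM m (k + 1) (m * q)).card := by
          refine Finset.card_le_card_of_injOn (fun q => (q % m, q / m)) ?_ ?_
          · intro q hq
            simp only [Finset.coe_filter, Finset.mem_range, Set.mem_ofPred_eq] at hq
            obtain ⟨hq, hd⟩ := hq
            rw [(pM_modEq m k (m * q) hm).dvd_iff dvd_rfl, Nat.mul_div_cancel_left q hm] at hd
            have hr := Nat.mod_lt q hm
            simp only [Finset.mem_coe, Finset.mem_product, Finset.mem_range, Finset.mem_filter]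
            refine ⟨?_, Nat.div_lt_of_lt_mul (by rwa [← pow_succ']), fun h => hd ?_⟩
            · by_contra hlt
              exact hd (Dvd.dvd.mul_right (by rw [show q % m + 1 = m by omega]) _)
            · rw [← Nat.div_add_mod q m, pM_succ_mul_add m k _ _ hr]
              exact h.mul_left _
          · intro a _ b _ hab
            simp only [Prod.mk.injEq] at hab
            rw [← Nat.div_add_mod a m, ← Nat.div_add_mod b m, hab.1, hab.2]
      _ ≤ (m - 1) ^ (k + 1) := by
          rw [Finset.card_product, Finset.card_range, pow_succ']
          exact Nat.mul_le_mul_left _ ih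

theorem pow_succ_le_rM_add (m k : ℕ) (hm : 0 < m) :
    m ^ (k + 1) ≤ rM 0 m (k + 1) + m * (m - 1) ^ k := by
  have hbad : ((Finset.range (m ^ (k + 1))).filter fun n => ¬ pM m (k + 1) n % m = 0).card ≤
      m * (m - 1) ^ k := by
    calc _ ≤ (Finset.range m ×ˢ
          (Finset.range (m ^ k)).filter fun q => ¬ m ∣ pM m (k + 1) (m * q)).card := by
          refine Finset.card_le_card_of_injOn (fun q => (q % m, q / m)) ?_ ?_
          · intro n hn
            simp only [Finset.coe_filter, Finset.mem_range, Set.mem_ofPred_eq] at hn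
            obtain ⟨hn, hd⟩ := hn
            have hr := Nat.mod_lt n hm
            simp only [Finset.mem_coe, Finset.mem_product, Finset.mem_range, Finset.mem_filter]
            refine ⟨hr, Nat.div_lt_of_lt_mul (by rwa [← pow_succ']), fun h => hd ?_⟩
            rw [← Nat.div_add_mod n m, pM_succ_mul_add m k _ _ hr]
            exact Nat.mod_eq_zero_of_dvd h
          · intro a _ b _ hab
            simp only [Prod.mk.injEq] at hab
            rw [← Nat.div_add_mod a m, ← Nat.div_add_mod b m, hab.1, hab.2]
      _ ≤ m * (m - 1) ^ k := by
          rw [Finset.card_product, Finset.card_range]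
          exact Nat.mul_le_mul_left _ (card_not_dvd_pM_le m k hm)
  have h := Finset.card_filter_add_card_filter_not (s := Finset.range (m ^ (k + 1)))
    (fun n => pM m (k + 1) n % m = 0)
  rw [Finset.card_range] at h
  rw [rM]
  omega

theorem stmt_19 (m : ℕ) (hm : 2 ≤ m) :
    Tendsto (fun k : ℕ => (rM 0 m k : ℝ) / (m : ℝ) ^ k) atTop (nhds 1) := by
  have hm0 : (0 : ℝ) < m := by positivity
  rw [← tendsto_add_atTop_iff_nat 1]
  have hlow : Tendsto (fun k : ℕ => 1 - (((m : ℝ) - 1) / m) ^ k) atTop (nhds 1) := by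
    have hm1 : (1 : ℝ) ≤ m := by exact_mod_cast (by omega : 1 ≤ m)
    have h := tendsto_pow_atTop_nhds_zero_of_lt_one (r := ((m : ℝ) - 1) / m)
      (div_nonneg (by linarith) hm0.le) (by rw [div_lt_one hm0]; linarith)
    simpa using h.const_sub 1
  refine tendsto_of_tendsto_of_tendsto_of_le_of_le hlow tendsto_const_nhds (fun k => ?_)
    (fun k => ?_)
  · have h : (m : ℝ) ^ (k + 1) ≤ rM 0 m (k + 1) + m * ((m : ℝ) - 1) ^ k := by
      have h := pow_succ_le_rM_add m k (by omega)
      have hc : ((m - 1 : ℕ) : ℝ) = (m : ℝ) - 1 := by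
        rw [Nat.cast_sub (by omega), Nat.cast_one]
      rw [← hc]
      exact_mod_cast h
    simp only
    rw [le_div_iff₀ (by positivity), sub_mul, div_pow, one_mul, pow_succ' (m : ℝ) k,
      mul_left_comm, div_mul_cancel₀ _ (by positivity), ← pow_succ']
    linarith
  · have h : rM 0 m (k + 1) ≤ m ^ (k + 1) := by
      simpa [rM] using Finset.card_filter_le (Finset.range (m ^ (k + 1))) _
    have h' : (rM 0 m (k + 1) : ℝ) ≤ (m : ℝ) ^ (k + 1) := by exact_mod_cast h
    exact div_le_one_of_le₀ h' (by positivity)
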